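/- arXiv:2203.05552 — 12 statements merged into one kernel-verified Lean document; each statement's English description precedes it below -/
import Mathlib

section
/- Let X be a set and let T : X³ → X³ be a map satisfying the tetrahedron equation T¹²³∘T¹⁴⁵∘T²⁴⁶∘T³⁵⁶ = T³⁵⁶∘T²⁴⁶∘T¹⁴⁵∘T¹²³. Let P¹³ : X³ → X³ be the permutation map P¹³(a₁,a₂,a₃) = (a₃,a₂,a₁). Then the map T̃ = P¹³∘T∘P¹³ also satisfies the tetrahedron equation. -/
/-- `T^{123}` : the map acting as `T` on factors 1,2,3 of `X⁶` and as identity elsewhere. -/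
def t123 {X : Type*} (T : X × X × X → X × X × X) : X × X × X × X × X × X → X × X × X × X × X × X
  | (a, b, c, d, e, f) => match T (a, b, c) with
    | (a', b', c') => (a', b', c', d, e, f)

/-- `T^{145}` : the map acting as `T` on factors 1,4,5 of `X⁶` and as identity elsewhere. -/
def t145 {X : Type*} (T : X × X × X → X × X × X) : X × X × X × X × X × X → X × X × X × X × X × X
  | (a, b, c, d, e, f) => match T (a, d, e) with
    | (a', d', e') => (a', b, c, d', e', f)

/-- `T^{246}` : the map acting as `T` on factors 2,4,6 of `X⁶` and as identity elsewhere. -/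
def t246 {X : Type*} (T : X × X × X → X × X × X) : X × X × X × X × X × X → X × X × X × X × X × X
  | (a, b, c, d, e, f) => match T (b, d, f) with
    | (b', d', f') => (a, b', c, d', e, f')

/-- `T^{356}` : the map acting as `T` on factors 3,5,6 of `X⁶` and as identity elsewhere. -/
def t356 {X : Type*} (T : X × X × X → X × X × X) : X × X × X × X × X × X → X × X × X × X × X × X
  | (a, b, c, d, e, f) => match T (c, e, f) with
    | (c', e', f') => (a, b, c', d, e', f')

/-- The Zamolodchikov tetrahedron equation for a map `T : X³ → X³`. -/
def IsTetrahedronMap {X : Type*} (T : X × X × X → X × X × X) : Prop :=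
  t123 T ∘ t145 T ∘ t246 T ∘ t356 T = t356 T ∘ t246 T ∘ t145 T ∘ t123 T

/-- The permutation map `P¹³(a₁,a₂,a₃) = (a₃,a₂,a₁)`. -/
def P13 {X : Type*} : X × X × X → X × X × X
  | (a, b, c) => (c, b, a)

/-- The involution of `X⁶` exchanging factors 1 and 6, and factors 2 and 5. -/
def swap16swap25 {X : Type*} : X × X × X × X × X × X → X × X × X × X × X × X
  | (a, b, c, d, e, f) => (f, e, c, d, b, a)

theorem swap16swap25_comp_self {X : Type*} :
    swap16swap25 ∘ swap16swap25 = (id : X × X × X × X × X × X → X × X × X × X × X × X) := rfl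

theorem t123_conj_P13 {X : Type*} (T : X × X × X → X × X × X) :
    t123 (P13 ∘ T ∘ P13) = swap16swap25 ∘ t356 T ∘ swap16swap25 := rfl

theorem t145_conj_P13 {X : Type*} (T : X × X × X → X × X × X) :
    t145 (P13 ∘ T ∘ P13) = swap16swap25 ∘ t246 T ∘ swap16swap25 := rfl

theorem t246_conj_P13 {X : Type*} (T : X × X × X → X × X × X) :
    t246 (P13 ∘ T ∘ P13) = swap16swap25 ∘ t145 T ∘ swap16swap25 := rfl

theorem t356_conj_P13 {X : Type*} (T : X × X × X → X × X × X) :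
    t356 (P13 ∘ T ∘ P13) = swap16swap25 ∘ t123 T ∘ swap16swap25 := rfl

/-- If `T` satisfies the tetrahedron equation, then so does `T̃ = P¹³ ∘ T ∘ P¹³`. -/
theorem stmt0 {X : Type*} (T : X × X × X → X × X × X) (hT : IsTetrahedronMap T) :
    IsTetrahedronMap (P13 ∘ T ∘ P13) := by
  have hS (x : X × X × X × X × X × X) : swap16swap25 (swap16swap25 x) = x :=
    congrFun swap16swap25_comp_self x
  rw [IsTetrahedronMap, t123_conj_P13, t145_conj_P13, t246_conj_P13, t356_conj_P13]
  funext x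
  simpa only [Function.comp_apply, hS] using
    congrArg swap16swap25 (congrFun hT (swap16swap25 x)).symm
end

section
/- Let A be an associative ring (not necessarily unital). The map T : A³ → A³ given by T(X,Y,Z) = (X, Y + XZ, Z) satisfies the tetrahedron equation T¹²³∘T¹⁴⁵∘T²⁴⁶∘T³⁵⁶ = T³⁵⁶∘T²⁴⁶∘T¹⁴⁵∘T¹²³. -/
/-- For any associative (not necessarily unital) ring `A`, the map
`T(X,Y,Z) = (X, Y + XZ, Z)` satisfies the tetrahedron equation. -/
theorem stmt1 {A : Type*} [NonUnitalRing A] :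
    IsTetrahedronMap (fun P : A × A × A => (P.1, P.2.1 + P.1 * P.2.2, P.2.2)) := by
  funext ⟨a, b, c, d, e, f⟩
  have h : d + b * f + a * (e + c * f) = d + a * e + (b + a * c) * f := by
    rw [mul_add, add_mul, mul_assoc]
    abel
  simp only [Function.comp_apply, t123, t145, t246, t356, h]
end

section
/- Let A be an associative ring (not necessarily unital). The map T̃ : A³ → A³ given by T̃(X,Y,Z) = (X, Y + ZX, Z) satisfies the tetrahedron equation T̃¹²³∘T̃¹⁴⁵∘T̃²⁴⁶∘T̃³⁵⁶ = T̃³⁵⁶∘T̃²⁴⁶∘T̃¹⁴⁵∘T̃¹²³. -/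
/-- For any associative (not necessarily unital) ring `A`, the map
`T̃(X,Y,Z) = (X, Y + ZX, Z)` satisfies the tetrahedron equation. -/
theorem stmt2 {A : Type*} [NonUnitalRing A] :
    IsTetrahedronMap (fun P : A × A × A => (P.1, P.2.1 + P.2.2 * P.1, P.2.2)) := by
  funext ⟨a, b, c, d, e, f⟩
  simp only [Function.comp_apply, t123, t145, t246, t356, Prod.mk.injEq, true_and, and_true]
  noncomm_ring
end

section
/- Let A be an associative ring (not necessarily unital) and let M ∈ A. The map T_M : A³ → A³ given by T_M(X,Y,Z) = (X, Y + XMZ, Z) satisfies the tetrahedron equation T_M¹²³∘T_M¹⁴⁵∘T_M²⁴⁶∘T_M³⁵⁶ = T_M³⁵⁶∘T_M²⁴⁶∘T_M¹⁴⁵∘T_M¹²³. -/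
/-- For any associative (not necessarily unital) ring `A` and any `M ∈ A`, the map
`T_M(X,Y,Z) = (X, Y + XMZ, Z)` satisfies the tetrahedron equation. -/
theorem stmt3 {A : Type*} [NonUnitalRing A] (M : A) :
    IsTetrahedronMap (fun P : A × A × A => (P.1, P.2.1 + P.1 * M * P.2.2, P.2.2)) := by
  funext ⟨a, b, c, d, e, f⟩
  simp only [Function.comp_apply, t123, t145, t246, t356, Prod.mk.injEq, true_and, and_true]
  simp only [mul_add, add_mul, mul_assoc]
  abel
end

section
/- Let A be an associative ring (not necessarily unital) and let M ∈ A. The map T̃_M : A³ → A³ given by T̃_M(X,Y,Z) = (X, Y + ZMX, Z) satisfies the tetrahedron equation T̃_M¹²³∘T̃_M¹⁴⁵∘T̃_M²⁴⁶∘T̃_M³⁵⁶ = T̃_M³⁵⁶∘T̃_M²⁴⁶∘T̃_M¹⁴⁵∘T̃_M¹²³. -/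
/-- For any associative (not necessarily unital) ring `A` and any `M ∈ A`, the map
`T̃_M(X,Y,Z) = (X, Y + ZMX, Z)` satisfies the tetrahedron equation. -/
theorem stmt4 {A : Type*} [NonUnitalRing A] (M : A) :
    IsTetrahedronMap (fun P : A × A × A => (P.1, P.2.1 + P.2.2 * M * P.1, P.2.2)) := by
  funext ⟨a, b, c, d, e, f⟩
  simp only [t123, t145, t246, t356, Function.comp_apply, Prod.mk.injEq, true_and, and_true,
    mul_add, add_mul, mul_assoc]
  abel
end

section
/- Let K be a field, n a positive integer, and M an n×n matrix with entries in K. The map T_M : (Mat_n(K))³ → (Mat_n(K))³ given by T_M(X,Y,Z) = (X, Y + XMZ, Z) satisfies the tetrahedron equation T_M¹²³∘T_M¹⁴⁵∘T_M²⁴⁶∘T_M³⁵⁶ = T_M³⁵⁶∘T_M²⁴⁶∘T_M¹⁴⁵∘T_M¹²³. -/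
/-- For a field `K`, `n ≥ 1`, and an `n×n` matrix `M` over `K`, the map
`T_M(X,Y,Z) = (X, Y + XMZ, Z)` on triples of `n×n` matrices satisfies the
tetrahedron equation. -/
theorem stmt5 {K : Type*} [Field K] (n : ℕ) (hn : 0 < n) (M : Matrix (Fin n) (Fin n) K) :
    IsTetrahedronMap (fun P : Matrix (Fin n) (Fin n) K × Matrix (Fin n) (Fin n) K ×
        Matrix (Fin n) (Fin n) K => (P.1, P.2.1 + P.1 * M * P.2.2, P.2.2)) := by
  funext ⟨a, b, c, d, e, f⟩
  simp only [t123, t145, t246, t356, Function.comp_apply, Prod.mk.injEq, true_and, and_true]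
  noncomm_ring
end

section
/- Let K be a field, n a positive integer, and M an n×n matrix with entries in K. The map T̃_M : (Mat_n(K))³ → (Mat_n(K))³ given by T̃_M(X,Y,Z) = (X, Y + ZMX, Z) satisfies the tetrahedron equation T̃_M¹²³∘T̃_M¹⁴⁵∘T̃_M²⁴⁶∘T̃_M³⁵⁶ = T̃_M³⁵⁶∘T̃_M²⁴⁶∘T̃_M¹⁴⁵∘T̃_M¹²³. -/
/-- For a field `K`, `n ≥ 1`, and an `n×n` matrix `M` over `K`, the map
`T̃_M(X,Y,Z) = (X, Y + ZMX, Z)` on triples of `n×n` matrices satisfies the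
tetrahedron equation. -/
theorem stmt6 {K : Type*} [Field K] (n : ℕ) (hn : 0 < n) (M : Matrix (Fin n) (Fin n) K) :
    IsTetrahedronMap (fun P : Matrix (Fin n) (Fin n) K × Matrix (Fin n) (Fin n) K ×
        Matrix (Fin n) (Fin n) K => (P.1, P.2.1 + P.2.2 * M * P.1, P.2.2)) := by
  funext ⟨a, b, c, d, e, f⟩
  simp only [Function.comp_apply, t123, t145, t246, t356, Prod.mk.injEq, true_and, and_true]
  noncomm_ring
end

section
/- Let K be a field, n a positive integer, and m ∈ {1,…,n}. The map F_{n,m} : (Mat_n(K))³ → (Mat_n(K))³ given by F_{n,m}(X,Y,Z) = (X, Y + Σ_{i=1}^{m} C_i(X)·R_{n−m+i}(Z), Z), where C_i(X)·R_j(Z) is the n×n matrix with (k,l)-th entry x_{k,i} z_{j,l}, satisfies the tetrahedron equation F¹²³∘F¹⁴⁵∘F²⁴⁶∘F³⁵⁶ = F³⁵⁶∘F²⁴⁶∘F¹⁴⁵∘F¹²³. -/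
/-- The map `(x, y, z) ↦ (x, y + β x z, z)` is a tetrahedron map when `β` is biadditive and
associative. -/
theorem isTetrahedronMap_add_of_assoc {A : Type*} [AddCommMonoid A] (β : A → A → A)
    (add_left : ∀ x y z, β (x + y) z = β x z + β y z)
    (add_right : ∀ x y z, β x (y + z) = β x y + β x z)
    (assoc : ∀ x y z, β (β x y) z = β x (β y z)) :
    IsTetrahedronMap (fun P : A × A × A => (P.1, P.2.1 + β P.1 P.2.2, P.2.2)) := by
  funext ⟨a, b, c, d, e, f⟩
  simp only [Function.comp_apply, t123, t145, t246, t356, add_left, add_right, assoc]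
  ac_rfl

/-- The product of the columns of `X` selected by `f` with the rows of `Z` selected by `g`. -/
def colRowMul {ι κ R : Type*} [Fintype ι] [NonUnitalNonAssocSemiring R] (f g : ι → κ)
    (X Z : Matrix κ κ R) : Matrix κ κ R :=
  X.submatrix id f * Z.submatrix g id

theorem colRowMul_eq_sum {ι κ R : Type*} [Fintype ι] [NonUnitalNonAssocSemiring R] (f g : ι → κ)
    (X Z : Matrix κ κ R) :
    colRowMul f g X Z = ∑ i, Matrix.of (fun k l => X k (f i) * Z (g i) l) := by
  ext k l
  simp [colRowMul, Matrix.mul_apply, Matrix.sum_apply]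

theorem colRowMul_assoc {ι κ R : Type*} [Fintype ι] [NonUnitalSemiring R] (f g : ι → κ)
    (X Y Z : Matrix κ κ R) :
    colRowMul f g (colRowMul f g X Y) Z = colRowMul f g X (colRowMul f g Y Z) :=
  Matrix.mul_assoc (X.submatrix id f) (Y.submatrix g f) (Z.submatrix g id)

/-- Let `K` be a field, `n ≥ 1`, and `m ∈ {1,…,n}`.  The map
`F_{n,m}(X,Y,Z) = (X, Y + Σ_{i=1}^{m} C_i(X)·R_{n−m+i}(Z), Z)`, where `C_i(X)·R_j(Z)` is
the `n×n` matrix with `(k,l)`-th entry `x_{k,i} z_{j,l}`, satisfies the tetrahedron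
equation. -/
theorem stmt11 {K : Type*} [Field K] (n m : ℕ) (hm1 : 1 ≤ m) (hmn : m ≤ n) :
    IsTetrahedronMap (fun P : Matrix (Fin n) (Fin n) K × Matrix (Fin n) (Fin n) K ×
        Matrix (Fin n) (Fin n) K =>
      (P.1,
        P.2.1 + ∑ i : Fin m, Matrix.of (fun k l : Fin n =>
          P.1 k (Fin.castLE hmn i) * P.2.2 ⟨n - m + i.val, by have := i.isLt; omega⟩ l),
        P.2.2)) := by
  simp only [← colRowMul_eq_sum (Fin.castLE hmn)
    (fun i : Fin m => (⟨n - m + i.val, by have := i.isLt; omega⟩ : Fin n))]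
  exact isTetrahedronMap_add_of_assoc _
    (fun _ _ _ => by simp [colRowMul, Matrix.submatrix_add, Matrix.add_mul])
    (fun _ _ _ => by simp [colRowMul, Matrix.submatrix_add, Matrix.mul_add])
    (colRowMul_assoc _ _)
end

section
/- Let K be a field, n a positive integer, and m̂ ∈ {n+1,…,2n−1}. The map S_{n,m̂} : (Mat_n(K))³ → (Mat_n(K))³ given by S_{n,m̂}(X,Y,Z) = (X, Y + Σ_{i=1}^{2n−m̂} C_{m̂−n+i}(X)·R_i(Z), Z), where C_j(X)·R_i(Z) is the n×n matrix with (k,l)-th entry x_{k,j} z_{i,l}, satisfies the tetrahedron equation S¹²³∘S¹⁴⁵∘S²⁴⁶∘S³⁵⁶ = S³⁵⁶∘S²⁴⁶∘S¹⁴⁵∘S¹²³. -/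
/-- The map `(X, Y, Z) ↦ (X, Y + X.submatrix id u * Z.submatrix v id, Z)` satisfies the
tetrahedron equation for all index maps `u` and `v`. -/
theorem isTetrahedronMap_add_submatrix_mul {m ι R : Type*} [Fintype ι] [Semiring R]
    (u v : ι → m) :
    IsTetrahedronMap (fun P : Matrix m m R × Matrix m m R × Matrix m m R =>
      (P.1, P.2.1 + P.1.submatrix id u * P.2.2.submatrix v id, P.2.2)) := by
  funext ⟨a, b, c, d, e, f⟩
  have assoc :
      a.submatrix id u * (c.submatrix id u * f.submatrix v id).submatrix v id =
        (a.submatrix id u * c.submatrix v id).submatrix id u * f.submatrix v id :=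
    (Matrix.mul_assoc (a.submatrix id u) (c.submatrix v u) (f.submatrix v id)).symm
  simp only [Function.comp_apply, t123, t145, t246, t356, Matrix.submatrix_add, Pi.add_apply,
    Matrix.mul_add, Matrix.add_mul, assoc, Prod.mk.injEq, true_and, and_true]
  abel

/-- Let `K` be a field, `n ≥ 1`, and `m̂ ∈ {n+1,…,2n−1}`.  The map
`S_{n,m̂}(X,Y,Z) = (X, Y + Σ_{i=1}^{2n−m̂} C_{m̂−n+i}(X)·R_i(Z), Z)`, where `C_j(X)·R_i(Z)`
is the `n×n` matrix with `(k,l)`-th entry `x_{k,j} z_{i,l}`, satisfies the tetrahedron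
equation. -/
theorem stmt12 {K : Type*} [Field K] (n mh : ℕ) (h1 : n + 1 ≤ mh) (h2 : mh ≤ 2 * n - 1) :
    IsTetrahedronMap (fun P : Matrix (Fin n) (Fin n) K × Matrix (Fin n) (Fin n) K ×
        Matrix (Fin n) (Fin n) K =>
      (P.1,
        P.2.1 + ∑ i : Fin (2 * n - mh), Matrix.of (fun k l : Fin n =>
          P.1 k ⟨mh - n + i.val, by have := i.isLt; omega⟩ *
            P.2.2 ⟨i.val, by have := i.isLt; omega⟩ l),
        P.2.2)) := by
  convert isTetrahedronMap_add_submatrix_mul (R := K)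
    (fun i : Fin (2 * n - mh) => (⟨mh - n + i.val, by have := i.isLt; omega⟩ : Fin n))
    (fun i : Fin (2 * n - mh) => (⟨i.val, by have := i.isLt; omega⟩ : Fin n)) using 5 with P
  ext k l
  simp [Matrix.sum_apply, Matrix.mul_apply]
end

section
/- Let K be a field, n a positive integer, and m̂ ∈ {n+1,…,2n−1}. The map S̃_{n,m̂} : (Mat_n(K))³ → (Mat_n(K))³ given by S̃_{n,m̂}(X,Y,Z) = (X, Y + Σ_{i=1}^{2n−m̂} C_{m̂−n+i}(Z)·R_i(X), Z), where C_j(Z)·R_i(X) is the n×n matrix with (k,l)-th entry z_{k,j} x_{i,l}, satisfies the tetrahedron equation S̃¹²³∘S̃¹⁴⁵∘S̃²⁴⁶∘S̃³⁵⁶ = S̃³⁵⁶∘S̃²⁴⁶∘S̃¹⁴⁵∘S̃¹²³. -/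
/-- In a ring, `(x, y, z) ↦ (x, y + z * p * x, z)` is a tetrahedron map for every `p`. -/
theorem isTetrahedronMap_add_mul_mul {R : Type*} [NonUnitalRing R] (p : R) :
    IsTetrahedronMap (fun P : R × R × R => (P.1, P.2.1 + P.2.2 * p * P.1, P.2.2)) := by
  funext ⟨a, b, c, d, e, f⟩
  simp only [Function.comp_apply, t123, t145, t246, t356, Prod.mk.injEq, true_and, and_true]
  noncomm_ring

/-- A sum of products of selected columns of `Z` with selected rows of `X` has the form
`Z * P * X`, where `P` does not depend on `Z` and `X`. -/
theorem sum_of_col_mul_row {R n ι : Type*} [Semiring R] [Fintype n] [DecidableEq n] [Fintype ι]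
    (g h : ι → n) (Z X : Matrix n n R) :
    ∑ i, Matrix.of (fun k l => Z k (g i) * X (h i) l) =
      Z * ((1 : Matrix n n R).submatrix id g * (1 : Matrix n n R).submatrix h id) * X := by
  have hZ : Z * (1 : Matrix n n R).submatrix id g = Z.submatrix id g := by
    ext k i
    simp [Matrix.mul_apply, Matrix.one_apply]
  have hX : (1 : Matrix n n R).submatrix h id * X = X.submatrix h id := by
    ext i l
    simp [Matrix.mul_apply, Matrix.one_apply]
  rw [← Matrix.mul_assoc, hZ, Matrix.mul_assoc, hX]
  ext k l
  simp [Matrix.mul_apply, Matrix.sum_apply]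

/-- Let `K` be a field, `n ≥ 1`, and `m̂ ∈ {n+1,…,2n−1}`.  The map
`S̃_{n,m̂}(X,Y,Z) = (X, Y + Σ_{i=1}^{2n−m̂} C_{m̂−n+i}(Z)·R_i(X), Z)`, where `C_j(Z)·R_i(X)`
is the `n×n` matrix with `(k,l)`-th entry `z_{k,j} x_{i,l}`, satisfies the tetrahedron
equation. -/
theorem stmt14 {K : Type*} [Field K] (n mh : ℕ) (h1 : n + 1 ≤ mh) (h2 : mh ≤ 2 * n - 1) :
    IsTetrahedronMap (fun P : Matrix (Fin n) (Fin n) K × Matrix (Fin n) (Fin n) K ×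
        Matrix (Fin n) (Fin n) K =>
      (P.1,
        P.2.1 + ∑ i : Fin (2 * n - mh), Matrix.of (fun k l : Fin n =>
          P.2.2 k ⟨mh - n + i.val, by have := i.isLt; omega⟩ *
            P.1 ⟨i.val, by have := i.isLt; omega⟩ l),
        P.2.2)) := by
  simp only [sum_of_col_mul_row (fun i : Fin (2 * n - mh) => (⟨mh - n + i.val, by omega⟩ : Fin n))
    (fun i => ⟨i.val, by omega⟩)]
  exact isTetrahedronMap_add_mul_mul _
end

section
/- Let A be an associative unital ring and let K ∈ A be invertible. The map T_K : A³ → A³ given by T_K(X,Y,Z) = (X, YK + XZ, KZK⁻¹) satisfies the tetrahedron equation T_K¹²³∘T_K¹⁴⁵∘T_K²⁴⁶∘T_K³⁵⁶ = T_K³⁵⁶∘T_K²⁴⁶∘T_K¹⁴⁵∘T_K¹²³. -/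
/-- Let `A` be an associative unital ring and `K ∈ A` invertible.  The map
`T_K(X,Y,Z) = (X, YK + XZ, KZK⁻¹)` satisfies the tetrahedron equation. -/
theorem stmt15 {A : Type*} [Ring A] (K : Aˣ) :
    IsTetrahedronMap (fun P : A × A × A =>
      (P.1, P.2.1 * (K : A) + P.1 * P.2.2, (K : A) * P.2.2 * ((K⁻¹ : Aˣ) : A))) := by
  funext ⟨a, b, c, d, e, f⟩
  simp [t123, t145, t246, t356, mul_add, add_mul, mul_assoc, add_assoc, add_comm, add_left_comm]
end

section
/- Let A be an associative unital ring and let K ∈ A be invertible. The map T̃_K : A³ → A³ given by T̃_K(X,Y,Z) = (KXK⁻¹, YK + ZX, Z) satisfies the tetrahedron equation T̃_K¹²³∘T̃_K¹⁴⁵∘T̃_K²⁴⁶∘T̃_K³⁵⁶ = T̃_K³⁵⁶∘T̃_K²⁴⁶∘T̃_K¹⁴⁵∘T̃_K¹²³. -/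
/-- Let `A` be an associative unital ring and `K ∈ A` invertible.  The map
`T̃_K(X,Y,Z) = (KXK⁻¹, YK + ZX, Z)` satisfies the tetrahedron equation. -/
theorem stmt16 {A : Type*} [Ring A] (K : Aˣ) :
    IsTetrahedronMap (fun P : A × A × A =>
      ((K : A) * P.1 * ((K⁻¹ : Aˣ) : A), P.2.1 * (K : A) + P.2.2 * P.1, P.2.2)) := by
  funext ⟨a, b, c, d, e, f⟩
  simp only [t123, t145, t246, t356, Function.comp_apply, Prod.mk.injEq, true_and, and_true]
  constructor
  · simp [mul_add, add_mul, mul_assoc]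
  · simp only [mul_add, add_mul, mul_assoc, Units.inv_mul, mul_one]
    abel
end
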